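/- Let K be a field, G a group, and t_1, …, t_d : G → K functions that form coordinates on G, i.e., for every x ∈ G with x ≠ 1 there exists α with t_α(x) ≠ t_α(1). Suppose the coordinates are splittable: there exist a positive integer l and functions f_{αβ} : G → K and h_β : G → K (1 ≤ α ≤ d, 1 ≤ β ≤ l) such that t_α(x y) = Σ_{β=1}^l f_{αβ}(x) h_β(y) for all x, y ∈ G and all α. Then G is linear over K, i.e., there exist a positive integer n and an injective group homomorphism G → GL_n(K). -/

import Mathlib

open scoped MatrixGroups

/-- A faithful representation on a nontrivial finite-dimensional space gives an embedding into
a general linear group of positive degree. -/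
theorem Representation.exists_injective_hom_GL {K G V : Type*} [Field K] [Group G]
    [AddCommGroup V] [Module K V] [FiniteDimensional K V] [Nontrivial V]
    (ρ : Representation K G V) (hρ : Function.Injective ρ) :
    ∃ (n : ℕ) (_ : 0 < n) (σ : G →* GL (Fin n) K), Function.Injective σ := by
  let e := LinearMap.toMatrixAlgEquiv (Module.finBasis K V)
  refine ⟨Module.finrank K V, Module.finrank_pos,
    (Units.map (e : _ →* Matrix (Fin (Module.finrank K V)) (Fin (Module.finrank K V)) K)).comp
      (MonoidHom.toHomUnits ρ), fun x y hxy => hρ (e.injective ?_)⟩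
  exact congrArg Units.val hxy

/-- The left regular representation of `G` on the functions `G → K`. -/
def leftTranslation (K G : Type*) [Field K] [Group G] : Representation K G (G → K) where
  toFun g := LinearMap.funLeft K K (g⁻¹ * ·)
  map_one' := by ext; simp [LinearMap.funLeft_apply]
  map_mul' a b := by ext; simp [LinearMap.funLeft_apply, mul_assoc]

theorem leftTranslation_apply {K G : Type*} [Field K] [Group G] (g : G) (φ : G → K) (y : G) :
    leftTranslation K G g φ y = φ (g⁻¹ * y) := rfl

/-- The restriction of a representation to an invariant subspace. -/
def Representation.restrictInvariant {K G V : Type*} [Field K] [Group G]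
    [AddCommGroup V] [Module K V] (ρ : Representation K G V) (W : Submodule K V)
    (hW : ∀ g, ∀ v ∈ W, ρ g v ∈ W) : Representation K G W where
  toFun g := (ρ g).restrict (hW g)
  map_one' := by ext; simp
  map_mul' a b := by ext; simp

/-- **Lemma 1 (on splittable coordinates).**
If a group `G` admits `K`-valued coordinates `t_1, …, t_d` (i.e. the coordinates
separate every nontrivial element from the identity) which are splittable,
`t_α (x y) = Σ_β f_{αβ}(x) h_β(y)`, then `G` is linear over `K`. -/
theorem splittable_coordinates_linear {K : Type*} [Field K] {G : Type*} [Group G]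
    (d l : ℕ) (hd : 0 < d) (hl : 0 < l)
    (t : Fin d → G → K) (f : Fin d → Fin l → G → K) (h : Fin l → G → K)
    (hcoord : ∀ x : G, x ≠ 1 → ∃ α : Fin d, t α x ≠ t α 1)
    (hsplit : ∀ (α : Fin d) (x y : G), t α (x * y) = ∑ β : Fin l, f α β x * h β y) :
    ∃ (n : ℕ) (_ : 0 < n) (ρ : G →* GL (Fin n) K), Function.Injective ρ := by
  let S : Set (G → K) :=
    insert (fun _ => 1) (Set.range fun p : Fin d × G => fun y => t p.1 (p.2 * y))
  let W : Submodule K (G → K) := Submodule.span K S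
  have one_mem : (fun _ => 1 : G → K) ∈ W := Submodule.subset_span (Set.mem_insert _ _)
  have t_mem (α : Fin d) (x : G) : (fun y => t α (x * y)) ∈ W :=
    Submodule.subset_span (Set.mem_insert_of_mem _ ⟨(α, x), rfl⟩)
  have invariant : ∀ g, ∀ φ ∈ W, leftTranslation K G g φ ∈ W := by
    intro g
    suffices W ≤ W.comap (leftTranslation K G g) from fun φ hφ => this hφ
    refine Submodule.span_le.2 ?_
    rintro _ (rfl | ⟨⟨α, x⟩, rfl⟩)
    · exact one_mem
    · have := t_mem α (x * g⁻¹)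
      simp only [mul_assoc] at this
      exact this
  have le_span : W ≤ Submodule.span K (insert (fun _ => 1) (Set.range h)) := by
    refine Submodule.span_le.2 ?_
    rintro _ (rfl | ⟨⟨α, x⟩, rfl⟩)
    · exact Submodule.subset_span (Set.mem_insert _ _)
    · have : (fun y => t α (x * y)) = ∑ β, f α β x • h β := by
        ext y
        simp [hsplit]
      simp only [this]
      exact Submodule.sum_mem _ fun β _ => Submodule.smul_mem _ _
        (Submodule.subset_span (Set.mem_insert_of_mem _ ⟨β, rfl⟩))
  have : FiniteDimensional K (Submodule.span K (insert (fun _ => 1 : G → K) (Set.range h))) :=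
    FiniteDimensional.span_of_finite K ((Set.finite_range h).insert _)
  have : FiniteDimensional K W := Submodule.finiteDimensional_of_le le_span
  have : Nontrivial W :=
    ⟨⟨⟨_, one_mem⟩, 0, fun h0 => one_ne_zero (congrFun (congrArg Subtype.val h0) 1)⟩⟩
  refine ((leftTranslation K G).restrictInvariant W invariant).exists_injective_hom_GL ?_
  refine (injective_iff_map_eq_one _).2 fun g hg => ?_
  by_contra hne
  obtain ⟨α, hα⟩ := hcoord g⁻¹ (inv_ne_one.2 hne)
  apply hα
  have key := congrFun (congrArg Subtype.val (LinearMap.congr_fun hg ⟨_, t_mem α 1⟩)) 1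
  change t α (1 * (g⁻¹ * 1)) = t α (1 * 1) at key
  simpa using key
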